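/- arXiv:math/0511204 — 8 statements merged into one kernel-verified Lean document; each statement's English description precedes it below -/
import Mathlib

section
/- Assume |a|_p < |b|_p. Then the open ball B_{1/|b|_p}(0) = {x ∈ ℚ_p : |x|_p < 1/|b|_p} is contained in the basin of attraction of the fixed point 0: for every x with |x|_p < 1/|b|_p, all iterates fⁿ(x) are defined (never equal P) and fⁿ(x) → 0 as n → ∞. -/
open Function Filter

theorem norm_mul_add_one_eq_one {p : ℕ} [Fact p.Prime] {b y : ℚ_[p]}
    (hb : b ≠ 0) (hy : ‖y‖ < 1 / ‖b‖) : ‖b * y + 1‖ = 1 := by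
  have h : ‖b * y‖ < 1 := by
    rw [norm_mul, mul_comm]
    exact (lt_div_iff₀ (norm_pos_iff.2 hb)).1 hy
  rw [IsUltrametricDist.norm_add_eq_max_of_norm_ne_norm (by rw [norm_one]; exact h.ne),
    norm_one, max_eq_right h.le]

theorem norm_mul_sq_div_le {p : ℕ} [Fact p.Prime] {a b y : ℚ_[p]}
    (hb : b ≠ 0) (hy : ‖y‖ < 1 / ‖b‖) :
    ‖a * y ^ 2 / (b * y + 1)‖ ≤ ‖a‖ / ‖b‖ * ‖y‖ := by
  rw [norm_div, norm_mul_add_one_eq_one hb hy, div_one, norm_mul, norm_pow]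
  calc ‖a‖ * ‖y‖ ^ 2 = ‖a‖ * ‖y‖ * ‖y‖ := by ring
    _ ≤ ‖a‖ * (1 / ‖b‖) * ‖y‖ := by gcongr
    _ = ‖a‖ / ‖b‖ * ‖y‖ := by ring

/-- If |a|_p < |b|_p, then the open ball of radius 1/|b|_p about 0 lies in the
basin of attraction of the fixed point 0 of f(x) = a·x²/(b·x+1): every orbit
starting there avoids the pole P = −1/b and converges to 0. -/
theorem ball_subset_basin_of_zero {p : ℕ} [Fact p.Prime] (a b : ℚ_[p])
    (ha : a ≠ 0) (hb : b ≠ 0) (hab : a ≠ b) (hnorm : ‖a‖ < ‖b‖)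
    (f : ℚ_[p] → ℚ_[p]) (hf : ∀ x, f x = a * x ^ 2 / (b * x + 1))
    (P : ℚ_[p]) (hP : P = -1 / b)
    (x : ℚ_[p]) (hx : ‖x‖ < 1 / ‖b‖) :
    (∀ n : ℕ, f^[n] x ≠ P) ∧
      Tendsto (fun n : ℕ => f^[n] x) atTop (nhds 0) := by
  have hk : ‖a‖ / ‖b‖ < 1 := (div_lt_one (norm_pos_iff.2 hb)).2 hnorm
  have hk0 : 0 ≤ ‖a‖ / ‖b‖ := by positivity
  have hbound : ∀ n : ℕ, ‖f^[n] x‖ ≤ (‖a‖ / ‖b‖) ^ n * ‖x‖ ∧ ‖f^[n] x‖ < 1 / ‖b‖ := by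
    intro n
    induction n with
    | zero => simpa using hx
    | succ n ih =>
      have hstep := norm_mul_sq_div_le (a := a) hb ih.2
      rw [← hf] at hstep
      rw [iterate_succ_apply']
      refine ⟨hstep.trans ?_, (hstep.trans
        (mul_le_of_le_one_left (norm_nonneg _) hk.le)).trans_lt ih.2⟩
      rw [pow_succ', mul_assoc]
      exact mul_le_mul_of_nonneg_left ih.1 hk0
  refine ⟨fun n hn => ?_, ?_⟩
  · have h := (hbound n).2
    rw [hn, hP, norm_div, norm_neg, norm_one] at h
    exact lt_irrefl _ h
  · refine squeeze_zero_norm (fun n => (hbound n).1) ?_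
    simpa using (tendsto_pow_atTop_nhds_zero_of_lt_one hk0 hk).mul_const ‖x‖
end

section
/- (Theorem 3.3) Assume |a|_p < |b|_p. Define r_n = |b|_p^{n−1}/|a|_p^n for n ≥ 0, and l_0 = 0, l_{n+1} = |a|_p^n/|b|_p^{n+1} for n ≥ 0. If x ∈ D satisfies |x|_p ≠ r_i for every i ≥ 1 and |x − P|_p ≠ l_j for every j ≥ 0, then x lies in the basin of attraction of 0: all iterates fⁿ(x) are defined (never equal P) and fⁿ(x) → 0 as n → ∞. -/
open Function Filter

/-- Away from the unit sphere of `b * y`, the map `y ↦ a y² / (b y + 1)` contracts the norm by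
`‖a‖ / ‖b‖`, with equality outside the unit ball. -/
lemma norm_quadratic_div_linear {p : ℕ} [Fact p.Prime] {a b y : ℚ_[p]}
    (ha : a ≠ 0) (hb : b ≠ 0) (hy : ‖y‖ * ‖b‖ ≠ 1) :
    ‖a * y ^ 2 / (b * y + 1)‖ ≤ ‖a‖ / ‖b‖ * ‖y‖ ∧
      (1 < ‖y‖ * ‖b‖ → ‖a * y ^ 2 / (b * y + 1)‖ = ‖a‖ / ‖b‖ * ‖y‖) := by
  have hB : 0 < ‖b‖ := norm_pos_iff.2 hb
  have hA : 0 < ‖a‖ := norm_pos_iff.2 ha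
  have hmax : ‖b * y + 1‖ = max (‖y‖ * ‖b‖) 1 := by
    have h := Padic.add_eq_max_of_ne (q := b * y) (r := 1)
      (by rwa [norm_mul, norm_one, mul_comm])
    rwa [norm_mul, norm_one, mul_comm ‖b‖] at h
  rw [norm_div, norm_mul, norm_pow, hmax]
  rcases lt_or_gt_of_ne hy with h | h
  · refine ⟨?_, fun h' => absurd h' h.not_gt⟩
    rw [max_eq_right h.le, div_one, div_mul_eq_mul_div, le_div_iff₀ hB]
    have := mul_le_mul_of_nonneg_left h.le (mul_nonneg hA.le (norm_nonneg y))
    linarith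
  · have hY : ‖y‖ ≠ 0 := by
      intro h0
      rw [h0, zero_mul] at h
      linarith
    have key : ‖a‖ * ‖y‖ ^ 2 / max (‖y‖ * ‖b‖) 1 = ‖a‖ / ‖b‖ * ‖y‖ := by
      rw [max_eq_left h.le]
      field_simp
    exact ⟨key.le, fun _ => key⟩

/-- If `‖y‖ * ‖b‖` is not of the form `(‖b‖ / ‖a‖) ^ k`, the orbit of `y` never meets the pole
and converges to `0`. -/
lemma iterate_ne_pole_and_tendsto_zero {p : ℕ} [Fact p.Prime] {a b : ℚ_[p]}
    (ha : a ≠ 0) (hb : b ≠ 0) (hnorm : ‖a‖ < ‖b‖)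
    {f : ℚ_[p] → ℚ_[p]} (hf : ∀ x, f x = a * x ^ 2 / (b * x + 1))
    {y : ℚ_[p]} (hy : ∀ k : ℕ, ‖y‖ * ‖b‖ * (‖a‖ / ‖b‖) ^ k ≠ 1) :
    (∀ n : ℕ, f^[n] y ≠ -1 / b) ∧ Tendsto (fun n : ℕ => f^[n] y) atTop (nhds 0) := by
  have hB : 0 < ‖b‖ := norm_pos_iff.2 hb
  have hq0 : 0 ≤ ‖a‖ / ‖b‖ := by positivity
  have hq1 : ‖a‖ / ‖b‖ < 1 := (div_lt_one hB).2 hnorm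
  have step : ∀ z : ℚ_[p], (∀ k : ℕ, ‖z‖ * ‖b‖ * (‖a‖ / ‖b‖) ^ k ≠ 1) →
      ‖f z‖ ≤ ‖a‖ / ‖b‖ * ‖z‖ ∧ ∀ k : ℕ, ‖f z‖ * ‖b‖ * (‖a‖ / ‖b‖) ^ k ≠ 1 := by
    intro z hz
    have hz0 : ‖z‖ * ‖b‖ ≠ 1 := by simpa using hz 0
    obtain ⟨hle, heq⟩ := norm_quadratic_div_linear ha hb hz0
    rw [← hf] at hle heq
    refine ⟨hle, fun k => ?_⟩
    rcases lt_or_gt_of_ne hz0 with h | h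
    · have h1 : ‖f z‖ ≤ ‖z‖ := hle.trans (mul_le_of_le_one_left (norm_nonneg z) hq1.le)
      have h2 : ‖f z‖ * ‖b‖ < 1 := (mul_le_mul_of_nonneg_right h1 hB.le).trans_lt h
      exact ((mul_le_of_le_one_right (by positivity) (pow_le_one₀ hq0 hq1.le)).trans_lt h2).ne
    · rw [heq h]
      convert hz (k + 1) using 1
      ring
  have bound : ∀ n : ℕ, ‖f^[n] y‖ ≤ (‖a‖ / ‖b‖) ^ n * ‖y‖ ∧
      ∀ k : ℕ, ‖f^[n] y‖ * ‖b‖ * (‖a‖ / ‖b‖) ^ k ≠ 1 := by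
    intro n
    induction n with
    | zero => exact ⟨by simp, by simpa using hy⟩
    | succ n ih =>
      rw [iterate_succ_apply']
      obtain ⟨h1, h2⟩ := step _ ih.2
      refine ⟨h1.trans ?_, h2⟩
      rw [pow_succ', mul_assoc]
      exact mul_le_mul_of_nonneg_left ih.1 hq0
  refine ⟨fun n hn => (bound n).2 0 ?_, ?_⟩
  · rw [hn, norm_div, norm_neg, norm_one, pow_zero, mul_one, one_div_mul_cancel hB.ne']
  · refine squeeze_zero_norm (fun n => (bound n).1) ?_
    simpa using (tendsto_pow_atTop_nhds_zero_of_lt_one hq0 hq1).mul_const ‖y‖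

/-- Theorem 3.3: assume |a|_p < |b|_p. With r_n = |b|_p^{n−1}/|a|_p^n and
l_0 = 0, l_{n+1} = |a|_p^n/|b|_p^{n+1}, every x ∈ D avoiding all the spheres
S_{r_i}(0) (i ≥ 1) and S_{l_j}(P) (j ≥ 0) lies in the basin of attraction of
the fixed point 0 of f(x) = a·x²/(b·x+1). -/
theorem basin_of_zero_repelling_case {p : ℕ} [Fact p.Prime] (a b : ℚ_[p])
    (ha : a ≠ 0) (hb : b ≠ 0) (hab : a ≠ b) (hnorm : ‖a‖ < ‖b‖)
    (f : ℚ_[p] → ℚ_[p]) (hf : ∀ x, f x = a * x ^ 2 / (b * x + 1))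
    (P : ℚ_[p]) (hP : P = -1 / b)
    (r : ℕ → ℝ) (hr : ∀ n : ℕ, r n = ‖b‖ ^ ((n : ℤ) - 1) / ‖a‖ ^ (n : ℤ))
    (l : ℕ → ℝ) (hl0 : l 0 = 0) (hl : ∀ n : ℕ, l (n + 1) = ‖a‖ ^ n / ‖b‖ ^ (n + 1))
    (x : ℚ_[p]) (hx : x ≠ P)
    (hxr : ∀ i : ℕ, 1 ≤ i → ‖x‖ ≠ r i)
    (hxl : ∀ j : ℕ, ‖x - P‖ ≠ l j) :
    (∀ n : ℕ, f^[n] x ≠ P) ∧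
      Tendsto (fun n : ℕ => f^[n] x) atTop (nhds 0) := by
  have hB : 0 < ‖b‖ := norm_pos_iff.2 hb
  have hA : 0 < ‖a‖ := norm_pos_iff.2 ha
  subst hP
  by_cases h1 : ‖x‖ * ‖b‖ = 1
  · have hfx : ∀ k : ℕ, ‖f x‖ * ‖b‖ * (‖a‖ / ‖b‖) ^ k ≠ 1 := by
      intro k hk
      have hd : 0 < ‖x - -1 / b‖ := norm_pos_iff.2 (sub_ne_zero.2 hx)
      have hlin : b * x + 1 = b * (x - -1 / b) := by
        field_simp
        ring
      have hX : ‖x‖ = 1 / ‖b‖ := eq_div_of_mul_eq hB.ne' h1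
      apply hxl (k + 2)
      rw [hl (k + 1)]
      rw [hf, hlin, norm_div, norm_mul, norm_mul, norm_pow, hX] at hk
      generalize ‖x - -1 / b‖ = d at hd hk ⊢
      simp only [div_pow] at hk
      field_simp at hk ⊢
      linear_combination -hk
    obtain ⟨hne, hlim⟩ := iterate_ne_pole_and_tendsto_zero ha hb hnorm hf hfx
    refine ⟨fun n => ?_, (tendsto_add_atTop_iff_nat 1).1 hlim⟩
    cases n with
    | zero => exact hx
    | succ n => exact hne n
  · refine iterate_ne_pole_and_tendsto_zero ha hb hnorm hf fun k hk => ?_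
    rcases Nat.eq_zero_or_pos k with rfl | hkpos
    · exact h1 (by simpa using hk)
    · apply hxr k hkpos
      rw [hr, zpow_sub₀ hB.ne', zpow_natCast, zpow_natCast, zpow_one]
      rw [div_pow] at hk
      field_simp at hk ⊢
      linear_combination hk
end

section
/- (Corollary 3.4) Assume |a|_p < |b|_p, and define r_n = |b|_p^{n−1}/|a|_p^n for n ≥ 0, l_0 = 0, l_{n+1} = |a|_p^n/|b|_p^{n+1} for n ≥ 0. If x ∈ Ω ∪ Ψ ∪ Σ, then either |x|_p = r_i for some i ≥ 1, or |x − P|_p = l_j for some j ≥ 0. -/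
open Function

section UltrametricQuadratic

variable {K : Type*} [NormedField K]

lemma norm_mul_quadratic_div {b : K} (hb : b ≠ 0) (a y : K) :
    ‖b * (a * y ^ 2 / (b * y + 1))‖ = ‖a‖ / ‖b‖ * ‖b * y‖ ^ 2 / ‖b * y + 1‖ := by
  have hb' : ‖b‖ ≠ 0 := norm_ne_zero_iff.2 hb
  simp only [norm_mul, norm_div, norm_pow]
  field_simp

variable [IsUltrametricDist K]

lemma norm_mul_quadratic_div_of_lt_one {b : K} (hb : b ≠ 0) (a : K) {y : K}
    (hy : ‖b * y‖ < 1) :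
    ‖b * (a * y ^ 2 / (b * y + 1))‖ = ‖a‖ / ‖b‖ * ‖b * y‖ ^ 2 := by
  have h : ‖b * y + 1‖ = 1 := by
    rw [IsUltrametricDist.norm_add_eq_max_of_norm_ne_norm (by rw [norm_one]; exact hy.ne),
      norm_one, max_eq_right hy.le]
  rw [norm_mul_quadratic_div hb, h, div_one]

lemma norm_mul_quadratic_div_of_one_lt {b : K} (hb : b ≠ 0) (a : K) {y : K}
    (hy : 1 < ‖b * y‖) :
    ‖b * (a * y ^ 2 / (b * y + 1))‖ = ‖a‖ / ‖b‖ * ‖b * y‖ := by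
  have h : ‖b * y + 1‖ = ‖b * y‖ := by
    rw [IsUltrametricDist.norm_add_eq_max_of_norm_ne_norm (by rw [norm_one]; exact hy.ne'),
      norm_one, max_eq_left hy.le]
  rw [norm_mul_quadratic_div hb, h]
  field_simp

/-- The points off every sphere `‖b * y‖ = (‖b‖ / ‖a‖) ^ i`, on which `‖y‖` never increases under
`y ↦ a * y ^ 2 / (b * y + 1)`. -/
def offCriticalSpheres (a b : K) : Set K :=
  {y | ∀ i : ℕ, ‖b * y‖ ≠ (‖b‖ / ‖a‖) ^ i}

omit [IsUltrametricDist K] in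
lemma norm_mul_ne_one_of_mem_offCriticalSpheres {a b y : K} (hy : y ∈ offCriticalSpheres a b) :
    ‖b * y‖ ≠ 1 := by
  simpa using hy 0

lemma norm_quadratic_div_lt {a b y : K} (hb : b ≠ 0) (hab : ‖a‖ < ‖b‖)
    (hy : ‖b * y‖ ≠ 1) (hy0 : y ≠ 0) : ‖a * y ^ 2 / (b * y + 1)‖ < ‖y‖ := by
  have hB : 0 < ‖b‖ := norm_pos_iff.2 hb
  have hpos : 0 < ‖b * y‖ := norm_pos_iff.2 (mul_ne_zero hb hy0)
  have hq : ‖a‖ / ‖b‖ < 1 := (div_lt_one hB).2 hab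
  have hq0 : 0 ≤ ‖a‖ / ‖b‖ := by positivity
  have key : ‖b * (a * y ^ 2 / (b * y + 1))‖ < ‖b * y‖ := by
    rcases hy.lt_or_gt with h | h
    · rw [norm_mul_quadratic_div_of_lt_one hb a h]
      nlinarith
    · rw [norm_mul_quadratic_div_of_one_lt hb a h]
      nlinarith
  rw [norm_mul, norm_mul b y] at key
  exact lt_of_mul_lt_mul_left key hB.le

lemma mapsTo_offCriticalSpheres {a b : K} (ha : a ≠ 0) (hb : b ≠ 0) (hab : ‖a‖ < ‖b‖) :
    Set.MapsTo (fun y ↦ a * y ^ 2 / (b * y + 1)) (offCriticalSpheres a b)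
      (offCriticalSpheres a b) := by
  intro y hy i
  have hA : 0 < ‖a‖ := norm_pos_iff.2 ha
  have hB : 0 < ‖b‖ := norm_pos_iff.2 hb
  rcases (norm_mul_ne_one_of_mem_offCriticalSpheres hy).lt_or_gt with h | h
  · have hq : ‖a‖ / ‖b‖ < 1 := (div_lt_one hB).2 hab
    have hi : 1 ≤ (‖b‖ / ‖a‖) ^ i := one_le_pow₀ ((one_le_div hA).2 hab.le)
    have hlt : ‖b * (a * y ^ 2 / (b * y + 1))‖ < 1 := by
      rw [norm_mul_quadratic_div_of_lt_one hb a h]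
      exact mul_lt_one_of_nonneg_of_lt_one_left (by positivity) hq
        (pow_le_one₀ (norm_nonneg _) h.le)
    exact (hlt.trans_le hi).ne
  · intro hi
    rw [norm_mul_quadratic_div_of_one_lt hb a h] at hi
    refine hy (i + 1) ?_
    rw [pow_succ, ← hi]
    field_simp

end UltrametricQuadratic

/-- Corollary 3.4: assume |a|_p < |b|_p. Every point of Ω ∪ Ψ ∪ Σ lies on one
of the spheres S_{r_i}(0) (i ≥ 1) or S_{l_j}(P) (j ≥ 0), where
r_n = |b|_p^{n−1}/|a|_p^n, l_0 = 0, l_{n+1} = |a|_p^n/|b|_p^{n+1}. -/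
theorem omega_psi_sigma_on_spheres {p : ℕ} [Fact p.Prime] (a b : ℚ_[p])
    (ha : a ≠ 0) (hb : b ≠ 0) (hab : a ≠ b) (hnorm : ‖a‖ < ‖b‖)
    (f : ℚ_[p] → ℚ_[p]) (hf : ∀ x, f x = a * x ^ 2 / (b * x + 1))
    (P : ℚ_[p]) (hP : P = -1 / b)
    (x₂ : ℚ_[p]) (hx₂ : x₂ = 1 / (a - b))
    (r : ℕ → ℝ) (hr : ∀ n : ℕ, r n = ‖b‖ ^ ((n : ℤ) - 1) / ‖a‖ ^ (n : ℤ))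
    (l : ℕ → ℝ) (hl0 : l 0 = 0) (hl : ∀ n : ℕ, l (n + 1) = ‖a‖ ^ n / ‖b‖ ^ (n + 1))
    (Ω : Set ℚ_[p])
    (hΩ : Ω = {x | x ≠ P ∧ ∃ i ≥ 1, (∀ m < i, f^[m] x ≠ P) ∧ f^[i] x = P})
    (Ψ : Set ℚ_[p])
    (hΨ : Ψ = {x | x ≠ P ∧ x ≠ x₂ ∧ ∃ j ≥ 1, (∀ m < j, f^[m] x ≠ P) ∧ f^[j] x = x₂})
    (Sig : Set ℚ_[p])
    (hSig : Sig = {x | x ≠ P ∧ x ≠ 0 ∧ x ≠ x₂ ∧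
      ∃ k ≥ 2, (∀ m < k, f^[m] x ≠ P) ∧ f^[k] x = x})
    (x : ℚ_[p]) (hx : x ∈ Ω ∪ Ψ ∪ Sig) :
    (∃ i : ℕ, 1 ≤ i ∧ ‖x‖ = r i) ∨ (∃ j : ℕ, ‖x - P‖ = l j) := by
  obtain rfl : f = fun y ↦ a * y ^ 2 / (b * y + 1) := funext hf
  set f : ℚ_[p] → ℚ_[p] := fun y ↦ a * y ^ 2 / (b * y + 1) with hfdef
  have hA : 0 < ‖a‖ := norm_pos_iff.2 ha
  have hB : 0 < ‖b‖ := norm_pos_iff.2 hb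
  by_contra! hcon
  obtain ⟨hxr, hxl⟩ := hcon
  have hbP : b * (x - P) = b * x + 1 := by
    rw [hP]
    field_simp
    ring
  have hxP : ‖x - P‖ = ‖b * x + 1‖ / ‖b‖ := by
    rw [← hbP, norm_mul]
    field_simp
  have hoff : ∀ i : ℕ, 1 ≤ i → ‖b * x‖ ≠ (‖b‖ / ‖a‖) ^ i := by
    intro i hi h
    refine hxr i hi ?_
    rw [hr, zpow_sub₀ hB.ne', zpow_one, zpow_natCast, zpow_natCast]
    rw [norm_mul, div_pow] at h
    rw [div_right_comm, ← h]
    field_simp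
  have hfx : f x ∈ offCriticalSpheres a b := by
    by_cases h1 : ‖b * x‖ = 1
    · intro i hi
      rw [norm_mul_quadratic_div hb, h1, one_pow, mul_one] at hi
      refine hxl (i + 2) ?_
      have hne : ‖b * x + 1‖ ≠ 0 := by
        intro h0
        exact hxl 0 (by rw [hxP, h0, zero_div, hl0])
      rw [hxP, hl]
      rw [div_pow] at hi
      field_simp at hi ⊢
      linear_combination -‖b‖ * hi
    · refine mapsTo_offCriticalSpheres ha hb hnorm fun i ↦ ?_
      rcases Nat.eq_zero_or_pos i with rfl | hi
      · simpa using h1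
      · exact hoff i hi
  have hiter : ∀ k : ℕ, 1 ≤ k → f^[k] x ∈ offCriticalSpheres a b := by
    intro k hk
    obtain ⟨m, rfl⟩ := Nat.exists_eq_add_of_le' hk
    rw [iterate_succ_apply]
    exact (mapsTo_offCriticalSpheres ha hb hnorm).iterate m hfx
  have hP1 : ‖b * P‖ = 1 := by
    rw [hP, mul_div_cancel₀ _ hb, norm_neg, norm_one]
  have hx₂1 : ‖b * x₂‖ = 1 := by
    have h : ‖a - b‖ = ‖b‖ := by
      rw [sub_eq_add_neg, IsUltrametricDist.norm_add_eq_max_of_norm_ne_norm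
        (by rw [norm_neg]; exact hnorm.ne), norm_neg, max_eq_right hnorm.le]
    rw [hx₂, norm_mul, norm_div, norm_one, h]
    field_simp
  subst hΩ hΨ hSig
  rcases hx with (⟨-, i, hi, -, h⟩ | ⟨-, -, j, hj, -, h⟩) | ⟨-, hx0, -, k, hk, -, h⟩
  · exact norm_mul_ne_one_of_mem_offCriticalSpheres (hiter i hi) (h ▸ hP1)
  · exact norm_mul_ne_one_of_mem_offCriticalSpheres (hiter j hj) (h ▸ hx₂1)
  · have hxoff : x ∈ offCriticalSpheres a b := h ▸ hiter k (by omega)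
    have hmono : ∀ y ∈ offCriticalSpheres a b, ‖f y‖ ≤ ‖y‖ := by
      intro y hy
      rcases eq_or_ne y 0 with rfl | hy0
      · simp [hfdef]
      · exact (norm_quadratic_div_lt hb hnorm
          (norm_mul_ne_one_of_mem_offCriticalSpheres hy) hy0).le
    have hle : ∀ m : ℕ, ‖f^[m + 1] x‖ ≤ ‖f x‖ := by
      intro m
      induction m with
      | zero => simp
      | succ m ih =>
        rw [iterate_succ_apply']
        exact (hmono _ (hiter _ (by omega))).trans ih
    have hlt : ‖f x‖ < ‖x‖ := norm_quadratic_div_lt hb hnorm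
      (norm_mul_ne_one_of_mem_offCriticalSpheres hxoff) hx0
    obtain ⟨m, rfl⟩ := Nat.exists_eq_add_of_le' (show 1 ≤ k by omega)
    exact (hle m).not_gt (by rwa [h])
end

section
/- (Theorem 3.6, attractor part) Assume p > 2 and |2a|_p > |b|_p. Then the basin of attraction of the fixed point 0 is exactly the open ball B_{1/|a|_p}(0): for x ∈ D, all iterates fⁿ(x) are defined and fⁿ(x) → 0 as n → ∞ if and only if |x|_p < 1/|a|_p. -/
open Function Filter

section QuadraticOverLinear

variable {K : Type*} [NormedField K] [IsUltrametricDist K] {a b y : K}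

theorem norm_mul_add_one_eq_one_s9 (hab : ‖b‖ ≤ ‖a‖) (hy : ‖a‖ * ‖y‖ < 1) : ‖b * y + 1‖ = 1 := by
  have h : ‖b * y‖ < ‖(1 : K)‖ := by
    rw [norm_mul, norm_one]
    exact (mul_le_mul_of_nonneg_right hab (norm_nonneg y)).trans_lt hy
  rw [IsUltrametricDist.norm_add_eq_max_of_norm_ne_norm h.ne, max_eq_right h.le, norm_one]

theorem norm_sq_div_eq_of_norm_lt (hab : ‖b‖ ≤ ‖a‖) (hy : ‖a‖ * ‖y‖ < 1) :
    ‖a * y ^ 2 / (b * y + 1)‖ = ‖a‖ * ‖y‖ * ‖y‖ := by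
  rw [norm_div, norm_mul_add_one_eq_one_s9 hab hy, norm_mul, norm_pow, div_one]
  ring

theorem one_le_norm_mul_norm_sq_div (hab : ‖b‖ ≤ ‖a‖) (hy : 1 ≤ ‖a‖ * ‖y‖)
    (hne : b * y + 1 ≠ 0) : 1 ≤ ‖a‖ * ‖a * y ^ 2 / (b * y + 1)‖ := by
  have hden : ‖b * y + 1‖ ≤ ‖a‖ * ‖y‖ := by
    refine (IsUltrametricDist.norm_add_le_max _ _).trans (max_le ?_ ?_)
    · rw [norm_mul]
      exact mul_le_mul_of_nonneg_right hab (norm_nonneg y)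
    · rwa [norm_one]
  rw [norm_div, norm_mul, norm_pow, ← mul_div_assoc, one_le_div (norm_pos_iff.mpr hne)]
  nlinarith

end QuadraticOverLinear

/-- Theorem 3.6 (attractor part): if p > 2 and |2a|_p > |b|_p, then the basin of
attraction of the fixed point 0 of f(x) = a·x²/(b·x+1) is exactly the open ball
B_{1/|a|_p}(0). -/
theorem basin_of_zero_indifferent_case {p : ℕ} [Fact p.Prime] (hp : 2 < p)
    (a b : ℚ_[p]) (ha : a ≠ 0) (hb : b ≠ 0) (hab : a ≠ b)
    (hnorm : ‖b‖ < ‖2 * a‖)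
    (f : ℚ_[p] → ℚ_[p]) (hf : ∀ x, f x = a * x ^ 2 / (b * x + 1))
    (P : ℚ_[p]) (hP : P = -1 / b)
    (x : ℚ_[p]) (hx : x ≠ P) :
    ((∀ n : ℕ, f^[n] x ≠ P) ∧ Tendsto (fun n : ℕ => f^[n] x) atTop (nhds 0)) ↔
      ‖x‖ < 1 / ‖a‖ := by
  have hab' : ‖b‖ < ‖a‖ := by
    refine hnorm.trans_le ?_
    rw [norm_mul]
    exact mul_le_of_le_one_left (norm_nonneg a) (by exact_mod_cast Padic.norm_int_le_one (p := p) 2)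
  have ha' : 0 < ‖a‖ := norm_pos_iff.mpr ha
  have hpole : ∀ y, b * y + 1 = 0 ↔ y = P := by
    intro y
    rw [hP, eq_div_iff hb, mul_comm b, eq_neg_iff_add_eq_zero]
  rw [lt_div_iff₀' ha']
  constructor
  · rintro ⟨hne, hlim⟩
    by_contra! hx1
    have hfar : ∀ n : ℕ, 1 ≤ ‖a‖ * ‖f^[n] x‖ := by
      intro n
      induction n with
      | zero => exact hx1
      | succ n ih =>
        rw [iterate_succ_apply', hf]
        exact one_le_norm_mul_norm_sq_div hab'.le ih (mt (hpole _).mp (hne n))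
    have hlim' := hlim.norm.const_mul ‖a‖
    rw [norm_zero, mul_zero] at hlim'
    exact absurd (ge_of_tendsto' hlim' hfar) (by norm_num)
  · intro hx1
    set q := ‖a‖ * ‖x‖
    have hq0 : 0 ≤ q := by positivity
    have hsmall : ∀ {n : ℕ}, ‖f^[n] x‖ ≤ q ^ n * ‖x‖ → ‖a‖ * ‖f^[n] x‖ ≤ q := by
      intro n h
      calc ‖a‖ * ‖f^[n] x‖ ≤ ‖a‖ * ‖x‖ := by
            gcongr
            exact h.trans (mul_le_of_le_one_left (norm_nonneg x) (pow_le_one₀ hq0 hx1.le))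
        _ = q := rfl
    have hbound : ∀ n : ℕ, ‖f^[n] x‖ ≤ q ^ n * ‖x‖ := by
      intro n
      induction n with
      | zero => simp
      | succ n ih =>
        rw [iterate_succ_apply', hf,
          norm_sq_div_eq_of_norm_lt hab'.le ((hsmall ih).trans_lt hx1), pow_succ', mul_assoc q]
        gcongr
        exact hsmall ih
    refine ⟨fun n hn => ?_, ?_⟩
    · have h := norm_mul_add_one_eq_one_s9 hab'.le ((hsmall (hbound n)).trans_lt hx1)
      rw [(hpole _).mpr hn, norm_zero] at h
      exact zero_ne_one h
    · refine squeeze_zero_norm hbound ?_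
      simpa using (tendsto_pow_atTop_nhds_zero_of_lt_one hq0 hx1).mul_const ‖x‖
end

section
/- (Theorem 3.6, Siegel disk part) Assume p > 2 and |2a|_p > |b|_p. Then the open ball B_{1/|a|_p}(x₂) is the maximal Siegel disk of the fixed point x₂ = 1/(a−b): (i) for every ρ with 0 < ρ < 1/|a|_p and every x with |x − x₂|_p = ρ, one has x ≠ P and |f(x) − x₂|_p = ρ (each such sphere is f-invariant); (ii) the point x₀ = −1/a satisfies |x₀ − x₂|_p = 1/|a|_p and f(x₀) = x₂, so the sphere of radius 1/|a|_p about x₂ is not invariant. -/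
theorem norm_add_eq_left_of_norm_lt {K : Type*} [NormedField K] [IsUltrametricDist K] {y z : K}
    (h : ‖z‖ < ‖y‖) : ‖y + z‖ = ‖y‖ := by
  rw [IsUltrametricDist.norm_add_eq_max_of_norm_ne_norm h.ne', max_eq_left h.le]

theorem Padic.norm_two_eq_one {p : ℕ} [Fact p.Prime] (hp : 2 < p) : ‖(2 : ℚ_[p])‖ = 1 := by
  exact_mod_cast Padic.norm_natCast_eq_one_iff.mpr
    ((Nat.coprime_primes Fact.out Nat.prime_two).mpr hp.ne')


/-- Theorem 3.6 (Siegel disk part): if p > 2 and |2a|_p > |b|_p, then the open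
ball B_{1/|a|_p}(x₂) is the maximal Siegel disk of the fixed point
x₂ = 1/(a−b) of f(x) = a·x²/(b·x+1): every sphere S_ρ(x₂) with
0 < ρ < 1/|a|_p is f-invariant, while x₀ = −1/a lies on the sphere of radius
1/|a|_p about x₂ and is mapped by f directly onto x₂. -/
theorem siegel_disk_indifferent_case {p : ℕ} [Fact p.Prime] (hp : 2 < p)
    (a b : ℚ_[p]) (ha : a ≠ 0) (hb : b ≠ 0) (hab : a ≠ b)
    (hnorm : ‖b‖ < ‖2 * a‖)
    (f : ℚ_[p] → ℚ_[p]) (hf : ∀ x, f x = a * x ^ 2 / (b * x + 1))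
    (P : ℚ_[p]) (hP : P = -1 / b)
    (x₂ : ℚ_[p]) (hx₂ : x₂ = 1 / (a - b)) :
    (∀ ρ : ℝ, 0 < ρ → ρ < 1 / ‖a‖ →
      ∀ x : ℚ_[p], ‖x - x₂‖ = ρ → x ≠ P ∧ ‖f x - x₂‖ = ρ) ∧
    ‖(-1 / a : ℚ_[p]) - x₂‖ = 1 / ‖a‖ ∧ f (-1 / a) = x₂ := by
  have h2a : ‖2 * a‖ = ‖a‖ := by rw [norm_mul, Padic.norm_two_eq_one hp, one_mul]
  have ha' : 0 < ‖a‖ := norm_pos_iff.mpr ha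
  have hc : a - b ≠ 0 := sub_ne_zero.mpr hab
  have hcn : ‖a - b‖ = ‖a‖ := by
    rw [sub_eq_add_neg]
    exact norm_add_eq_left_of_norm_lt (by rwa [norm_neg, ← h2a])
  have hdn : ‖2 * a - b‖ = ‖a‖ := by
    rw [← h2a, sub_eq_add_neg]
    exact norm_add_eq_left_of_norm_lt (by rwa [norm_neg])
  refine ⟨?_, ?_, ?_⟩
  · rintro ρ - hρ x hx
    obtain ⟨u, rfl⟩ : ∃ u, x = x₂ + u := ⟨x - x₂, by ring⟩
    rw [add_sub_cancel_left] at hx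
    have hau : ‖a * u‖ < 1 := by
      rw [norm_mul, hx, mul_comm]
      exact (lt_div_iff₀ ha').mp hρ
    have hbu : ‖b * u‖ < 1 := by
      refine lt_of_le_of_lt ?_ hau
      rw [norm_mul, norm_mul]
      exact mul_le_mul_of_nonneg_right (h2a ▸ hnorm.le) (norm_nonneg _)
    have hden : ‖b * (x₂ + u) + 1‖ = 1 := by
      have h1 : ‖a / (a - b)‖ = 1 := by rw [norm_div, hcn, div_self ha'.ne']
      have h2 : b * (x₂ + u) + 1 = a / (a - b) + b * u := by
        rw [hx₂]
        field_simp
        ring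
      rw [h2, norm_add_eq_left_of_norm_lt (by rwa [h1]), h1]
    have hden0 : b * (x₂ + u) + 1 ≠ 0 := norm_ne_zero_iff.mp (by rw [hden]; exact one_ne_zero)
    have hnum : ‖(2 * a - b) / (a - b) + a * u‖ = 1 := by
      have h1 : ‖(2 * a - b) / (a - b)‖ = 1 := by rw [norm_div, hcn, hdn, div_self ha'.ne']
      rw [norm_add_eq_left_of_norm_lt (by rwa [h1]), h1]
    refine ⟨?_, ?_⟩
    · intro h
      apply hden0
      rw [h, hP]
      field_simp
      ring
    · have h : f (x₂ + u) - x₂ =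
          u * ((2 * a - b) / (a - b) + a * u) / (b * (x₂ + u) + 1) := by
        rw [hf, eq_div_iff hden0, sub_mul, div_mul_cancel₀ _ hden0, hx₂]
        field_simp
        ring
      rw [h, norm_div, norm_mul, hnum, hden, hx, mul_one, div_one]
  · have h : -1 / a - x₂ = -((2 * a - b) / (a * (a - b))) := by
      rw [hx₂]
      field_simp
      ring
    rw [h, norm_neg, norm_div, norm_mul, hcn, hdn]
    field_simp
  · have h : b * (-1 / a) + 1 = (a - b) / a := by
      field_simp
      ring
    rw [hf, h, hx₂]
    field_simp
end

section
/- (Theorem 3.9) Assume p > 2, |2a|_p = |b|_p and |2a − b|_p < |a|_p. Then both fixed points are attracting and their basins are open balls of radius 1/|b|_p: for x ∈ D, all iterates fⁿ(x) are defined and fⁿ(x) → 0 if and only if |x|_p < 1/|b|_p; and all iterates fⁿ(x) are defined and fⁿ(x) → x₂ if and only if |x − x₂|_p < 1/|b|_p, where x₂ = 1/(a−b). -/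
open Function Filter

section Basin

variable {K : Type*} [NormedField K] [IsUltrametricDist K]

/-- The basin of a fixed point `c` of a map which, away from its pole `P`, has the form
`c + h ↦ c + h (a h + u) / (b h + v)` with `‖a‖ = ‖b‖`, `‖u‖ < 1` and `‖v‖ = 1`,
is the open ball of radius `1 / ‖b‖` about `c`. -/
theorem tendsto_iterate_iff_norm_sub_lt {f : K → K} {a b c u v P : K} (hb : b ≠ 0)
    (hab : ‖a‖ = ‖b‖) (hu : ‖u‖ < 1) (hv : ‖v‖ = 1)
    (hP : ∀ x, x = P ↔ b * (x - c) + v = 0)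
    (hf : ∀ x, x ≠ P → f x - c = (x - c) * (a * (x - c) + u) / (b * (x - c) + v)) (x : K) :
    ((∀ n : ℕ, f^[n] x ≠ P) ∧ Tendsto (fun n : ℕ => f^[n] x) atTop (nhds c)) ↔
      ‖x - c‖ < 1 / ‖b‖ := by
  have hb' : 0 < ‖b‖ := norm_pos_iff.2 hb
  have expand : ∀ y, y ≠ P → 1 / ‖b‖ ≤ ‖y - c‖ → 1 / ‖b‖ ≤ ‖f y - c‖ := by
    intro y hy hyc
    have h1 : 1 ≤ ‖b * (y - c)‖ := by
      rwa [norm_mul, mul_comm, ← div_le_iff₀ hb']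
    have hnum : ‖a * (y - c) + u‖ = ‖b * (y - c)‖ := by
      have hn : ‖a * (y - c)‖ = ‖b * (y - c)‖ := by rw [norm_mul, norm_mul, hab]
      have hlt : ‖u‖ < ‖a * (y - c)‖ := by linarith
      rw [IsUltrametricDist.norm_add_eq_max_of_norm_ne_norm hlt.ne', max_eq_left hlt.le, hn]
    have hden : ‖b * (y - c) + v‖ ≤ ‖b * (y - c)‖ :=
      (IsUltrametricDist.norm_add_le_max _ _).trans (max_le le_rfl (hv.trans_le h1))
    have hpos : 0 < ‖b * (y - c) + v‖ := norm_pos_iff.2 (mt (hP y).2 hy)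
    rw [hf y hy, norm_div, norm_mul, hnum]
    refine hyc.trans ?_
    rw [le_div_iff₀ hpos]
    gcongr
  have contract : ∀ y, ‖y - c‖ < 1 / ‖b‖ →
      y ≠ P ∧ ‖f y - c‖ ≤ ‖y - c‖ * max (‖b‖ * ‖y - c‖) ‖u‖ := by
    intro y hyc
    have h1 : ‖b * (y - c)‖ < ‖v‖ := by
      rwa [hv, norm_mul, mul_comm, ← lt_div_iff₀ hb']
    have hden : ‖b * (y - c) + v‖ = 1 := by
      rw [IsUltrametricDist.norm_add_eq_max_of_norm_ne_norm h1.ne, max_eq_right h1.le, hv]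
    have hy : y ≠ P := fun h => by simp [(hP y).1 h] at hden
    refine ⟨hy, ?_⟩
    rw [hf y hy, norm_div, norm_mul, hden, div_one, ← hab, ← norm_mul a]
    gcongr
    exact IsUltrametricDist.norm_add_le_max _ _
  constructor
  · rintro ⟨hn, ht⟩
    by_contra! hx
    have far : ∀ n : ℕ, 1 / ‖b‖ ≤ ‖f^[n] x - c‖ := by
      intro n
      induction n with
      | zero => exact hx
      | succ n ih =>
        rw [iterate_succ_apply']
        exact expand _ (hn n) ih
    have hlim := ge_of_tendsto' (tendsto_iff_norm_sub_tendsto_zero.1 ht) far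
    exact hlim.not_gt (by positivity)
  · intro hx
    set k := max (‖b‖ * ‖x - c‖) ‖u‖
    have hk0 : 0 ≤ k := (norm_nonneg u).trans (le_max_right _ _)
    have hk1 : k < 1 := max_lt (by rwa [mul_comm, ← lt_div_iff₀ hb']) hu
    have near : ∀ n : ℕ, ‖f^[n] x - c‖ ≤ k ^ n * ‖x - c‖ := by
      intro n
      induction n with
      | zero => simp
      | succ n ih =>
        have hle : ‖f^[n] x - c‖ ≤ ‖x - c‖ :=
          ih.trans (mul_le_of_le_one_left (norm_nonneg _) (pow_le_one₀ hk0 hk1.le))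
        rw [iterate_succ_apply']
        calc ‖f (f^[n] x) - c‖
            ≤ ‖f^[n] x - c‖ * max (‖b‖ * ‖f^[n] x - c‖) ‖u‖ := (contract _ (hle.trans_lt hx)).2
          _ ≤ (k ^ n * ‖x - c‖) * k := by gcongr; exact max_le_max (by gcongr) le_rfl
          _ = k ^ (n + 1) * ‖x - c‖ := by ring
    refine ⟨fun n => (contract _ (lt_of_le_of_lt ?_ hx)).1, ?_⟩
    · exact (near n).trans (mul_le_of_le_one_left (norm_nonneg _) (pow_le_one₀ hk0 hk1.le))
    · rw [tendsto_iff_norm_sub_tendsto_zero]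
      refine squeeze_zero (fun _ => norm_nonneg _) near ?_
      simpa using (tendsto_pow_atTop_nhds_zero_of_lt_one hk0 hk1).mul_const ‖x - c‖

end Basin

/-- Theorem 3.9: if p > 2, |2a|_p = |b|_p and |2a−b|_p < |a|_p, then both fixed
points x₁ = 0 and x₂ = 1/(a−b) of f(x) = a·x²/(b·x+1) are attracting and their
basins of attraction are exactly the open balls of radius 1/|b|_p about them. -/
theorem both_attracting_case_3_9 {p : ℕ} [Fact p.Prime] (hp : 2 < p)
    (a b : ℚ_[p]) (ha : a ≠ 0) (hb : b ≠ 0) (hab : a ≠ b)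
    (hnorm1 : ‖2 * a‖ = ‖b‖) (hnorm2 : ‖2 * a - b‖ < ‖a‖)
    (f : ℚ_[p] → ℚ_[p]) (hf : ∀ x, f x = a * x ^ 2 / (b * x + 1))
    (P : ℚ_[p]) (hP : P = -1 / b)
    (x₂ : ℚ_[p]) (hx₂ : x₂ = 1 / (a - b))
    (x : ℚ_[p]) (hx : x ≠ P) :
    (((∀ n : ℕ, f^[n] x ≠ P) ∧ Tendsto (fun n : ℕ => f^[n] x) atTop (nhds 0)) ↔
      ‖x‖ < 1 / ‖b‖) ∧
    (((∀ n : ℕ, f^[n] x ≠ P) ∧ Tendsto (fun n : ℕ => f^[n] x) atTop (nhds x₂)) ↔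
      ‖x - x₂‖ < 1 / ‖b‖) := by
  have h2 : ‖(2 : ℚ_[p])‖ = 1 := by
    have hcop : p.Coprime 2 :=
      (Nat.coprime_primes Fact.out Nat.prime_two).2 hp.ne'
    exact_mod_cast Padic.norm_natCast_eq_one_iff.2 hcop
  have hnorm : ‖a‖ = ‖b‖ := by rw [← hnorm1, norm_mul, h2, one_mul]
  have hsub : a - b ≠ 0 := sub_ne_zero.2 hab
  have hsub_norm : ‖a - b‖ = ‖a‖ := by
    have hlt : ‖2 * a - b‖ < ‖-a‖ := by rwa [norm_neg]
    rw [show a - b = (2 * a - b) + -a by ring,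
      IsUltrametricDist.norm_add_eq_max_of_norm_ne_norm hlt.ne, max_eq_right hlt.le, norm_neg]
  have ha' : 0 < ‖a‖ := norm_pos_iff.2 ha
  have hpole : ∀ y, y = P ↔ b * y + 1 = 0 := by
    intro y
    rw [hP, eq_div_iff hb, mul_comm, eq_neg_iff_add_eq_zero]
  have hv : ∀ y, b * (y - x₂) + a / (a - b) = b * y + 1 := by
    intro y
    rw [hx₂]
    field_simp
    ring
  constructor
  · simpa using tendsto_iterate_iff_norm_sub_lt (f := f) (c := 0) (u := 0) (v := 1) hb hnorm
      (by simp) norm_one (by simpa using hpole)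
      (fun y _ => by rw [hf]; simp only [sub_zero, add_zero]; ring) x
  · refine tendsto_iterate_iff_norm_sub_lt (u := (2 * a - b) / (a - b)) (v := a / (a - b))
      hb hnorm ?_ ?_ (fun y => by rw [hv, hpole]) (fun y hy => ?_) x
    · rwa [norm_div, hsub_norm, div_lt_one ha']
    · rw [norm_div, hsub_norm, div_self ha'.ne']
    · have hy' : b * y + 1 ≠ 0 := mt (hpole y).2 hy
      rw [hv, hf, hx₂, eq_div_iff hy', sub_mul, div_mul_cancel₀ _ hy']
      field_simp
      ring
end

section
/- Let p > 2 be a prime, b ∈ ℚ_p with 0 < |b|_p < 1, f(x) = x²/(bx + 1), x₂ = 1/(1−b), and let 0 < ρ < 1. Then the sphere S_ρ(x₂) is invariant under f: for every y with |y − x₂|_p = ρ one has b·y + 1 ≠ 0 and |f(y) − x₂|_p = ρ. -/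
/-- In `ℚ_[p]`, adding an element of norm less than one to a unit leaves its norm unchanged. -/
theorem Padic.norm_add_eq_one {p : ℕ} [Fact p.Prime] {u v : ℚ_[p]} (hu : ‖u‖ = 1)
    (hv : ‖v‖ < 1) : ‖u + v‖ = 1 := by
  rw [Padic.add_eq_max_of_ne (by rw [hu]; exact hv.ne'), hu, max_eq_left hv.le]

/-- For p > 2, 0 < |b|_p < 1, f(x) = x²/(bx+1), x₂ = 1/(1−b), and 0 < ρ < 1:
every sphere S_ρ(x₂) is invariant under f (and avoids the pole). -/
theorem sphere_invariant {p : ℕ} [Fact p.Prime] (hp : 2 < p)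
    (b : ℚ_[p]) (hb : b ≠ 0) (hbnorm : ‖b‖ < 1)
    (f : ℚ_[p] → ℚ_[p]) (hf : ∀ x, f x = x ^ 2 / (b * x + 1))
    (x₂ : ℚ_[p]) (hx₂ : x₂ = 1 / (1 - b))
    (ρ : ℝ) (hρ0 : 0 < ρ) (hρ1 : ρ < 1)
    (y : ℚ_[p]) (hy : ‖y - x₂‖ = ρ) :
    b * y + 1 ≠ 0 ∧ ‖f y - x₂‖ = ρ := by
  have h1b : ‖1 - b‖ = 1 := by
    rw [sub_eq_add_neg]
    exact Padic.norm_add_eq_one norm_one (by rwa [norm_neg])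
  have h1b0 : 1 - b ≠ 0 := norm_ne_zero_iff.1 (by rw [h1b]; exact one_ne_zero)
  have hx₂norm : ‖x₂‖ = 1 := by rw [hx₂, norm_div, h1b, norm_one, div_one]
  have hx₂mul : (1 - b) * x₂ = 1 := by rw [hx₂, mul_one_div_cancel h1b0]
  have hyx : ‖y - x₂‖ < 1 := hy ▸ hρ1
  have hynorm : ‖y‖ = 1 := by
    rw [← add_sub_cancel x₂ y]
    exact Padic.norm_add_eq_one hx₂norm hyx
  have hden : ‖b * y + 1‖ = 1 := by
    rw [add_comm]
    exact Padic.norm_add_eq_one norm_one (by rwa [norm_mul, hynorm, mul_one])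
  have hden0 : b * y + 1 ≠ 0 := norm_ne_zero_iff.1 (by rw [hden]; exact one_ne_zero)
  have hnum : ‖y + 1‖ = 1 := by
    have h : y + 1 = 2 + b * x₂ + (y - x₂) := by linear_combination hx₂mul
    rw [h]
    refine Padic.norm_add_eq_one (Padic.norm_add_eq_one (Padic.norm_two_eq_one hp) ?_) hyx
    rwa [norm_mul, hx₂norm, mul_one]
  have hfactor : f y - x₂ = (y - x₂) * (y + 1) / (b * y + 1) := by
    rw [hf, eq_div_iff hden0, sub_mul, div_mul_cancel₀ _ hden0]
    linear_combination y * hx₂mul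
  refine ⟨hden0, ?_⟩
  rw [hfactor, norm_div, norm_mul, hy, hnum, hden, mul_one, div_one]
end

section
/- (Lemma 4.2) Let p > 2 be a prime, b ∈ ℚ_p with 0 < |b|_p < 1, f(x) = x²/(bx + 1), x₂ = 1/(1−b), and 0 < ρ < 1. For every y on the sphere S_ρ(x₂) one has |f(y) − y|_p = ρ; consequently, for every r < ρ the balls B_r(y) and B_r(f(y)) are disjoint. -/
/-- Lemma 4.2: for p > 2, 0 < |b|_p < 1, f(x) = x²/(bx+1), x₂ = 1/(1−b), and
0 < ρ < 1: for every y on the sphere S_ρ(x₂), |f(y) − y|_p = ρ, hence for every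
r < ρ the balls B_r(y) and B_r(f(y)) are disjoint. -/
theorem image_ball_disjoint {p : ℕ} [Fact p.Prime] (hp : 2 < p)
    (b : ℚ_[p]) (hb : b ≠ 0) (hbnorm : ‖b‖ < 1)
    (f : ℚ_[p] → ℚ_[p]) (hf : ∀ x, f x = x ^ 2 / (b * x + 1))
    (x₂ : ℚ_[p]) (hx₂ : x₂ = 1 / (1 - b))
    (ρ : ℝ) (hρ0 : 0 < ρ) (hρ1 : ρ < 1)
    (y : ℚ_[p]) (hy : ‖y - x₂‖ = ρ) :
    ‖f y - y‖ = ρ ∧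
      ∀ r : ℝ, r < ρ → Metric.ball y r ∩ Metric.ball (f y) r = ∅ := by
  have h1b : ‖1 - b‖ = 1 := by
    rw [sub_eq_add_neg]
    exact Padic.norm_add_eq_one norm_one (by rwa [norm_neg])
  have h1b0 : 1 - b ≠ 0 := norm_ne_zero_iff.mp (by rw [h1b]; exact one_ne_zero)
  have hx₂norm : ‖x₂‖ = 1 := by rw [hx₂, norm_div, norm_one, h1b, div_one]
  have hynorm : ‖y‖ = 1 := by
    have h := Padic.norm_add_eq_one hx₂norm (hy.trans_lt hρ1)
    rwa [add_sub_cancel] at h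
  have hden : ‖b * y + 1‖ = 1 := by
    rw [add_comm]
    exact Padic.norm_add_eq_one norm_one (by rwa [norm_mul, hynorm, mul_one])
  have hden0 : b * y + 1 ≠ 0 := norm_ne_zero_iff.mp (by rw [hden]; exact one_ne_zero)
  have hfy : f y - y = y * (1 - b) * (y - x₂) / (b * y + 1) := by
    have hx₂mul : (1 - b) * x₂ = 1 := by rw [hx₂, mul_one_div_cancel h1b0]
    rw [hf, eq_div_iff hden0, sub_mul, div_mul_cancel₀ _ hden0]
    linear_combination y * hx₂mul
  have hdist : ‖f y - y‖ = ρ := by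
    rw [hfy, norm_div, norm_mul, norm_mul, hynorm, h1b, hden, hy]
    norm_num
  refine ⟨hdist, fun r hr ↦ Set.eq_empty_iff_forall_notMem.mpr ?_⟩
  rintro z ⟨hzy, hzf⟩
  have h := IsUltrametricDist.dist_triangle_max (f y) z y
  rw [dist_eq_norm (f y) y, hdist] at h
  rw [Metric.mem_ball] at hzy hzf
  rw [dist_comm] at hzf
  exact absurd (h.trans_lt (max_lt hzf hzy)) hr.not_gt
end
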